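/- arXiv:2204.10051 — 3 statements merged into one kernel-verified Lean document; each statement's English description precedes it below -/
import Mathlib

section
/- Suppose x satisfies the regularity assumption, and additionally x(h) − h/A is bounded on ℝ for some A > 0. Let −1 < m < 1, let ξ ∈ ℝ, let h := x^{−1} : ℝ → ℝ be the inverse function of x, and write x₀ := x(ξ). Then the iterated limit lim_{δ→0⁺, M→+∞} [ ∫_{x₀+δ}^{x₀+M} h'(y) (y−x₀)^{−(m+1)} dy − ∫_{x₀−M}^{x₀−δ} h'(y) (x₀−y)^{−(m+1)} dy ] exists and equals the improper integral ∫_0^∞ G_m(t;ξ) dt := lim_{δ→0⁺, M→+∞} ∫_δ^M G_m(t;ξ) dt; in other words, ∫_0^∞ G_m(t;ξ) dt = −P.V. ∫_ℝ (x₀−y) h'(y) |x₀−y|^{−(m+2)} dy. -/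
open Real Filter Topology MeasureTheory

/-- The real value of the Riemann zeta function (analytically continued). -/
noncomputable def zetaR (s : ℝ) : ℝ := (riemannZeta (s : ℂ)).re

/-- `G_s(h; ξ) = (x(ξ+h) - x(ξ))^{-(s+1)} - (x(ξ) - x(ξ-h))^{-(s+1)}`. -/
noncomputable def Gfun (x : ℝ → ℝ) (s ξ h : ℝ) : ℝ :=
  (x (ξ + h) - x ξ) ^ (-(s + 1)) - (x ξ - x (ξ - h)) ^ (-(s + 1))

/-- `σ^{(s)}(ξ, a) = a ∑_{k=1}^∞ G_s(k a; ξ)`. -/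
noncomputable def sigmaFun (x : ℝ → ℝ) (s ξ a : ℝ) : ℝ :=
  a * ∑' k : ℕ, Gfun x s ξ (((k : ℝ) + 1) * a)

/-- The regularity assumption on the vicinal surface `x`:
real analyticity, globally converging Taylor expansions, and `inf x' > 0`. -/
def RegularSurface (x : ℝ → ℝ) : Prop :=
  (∀ ξ : ℝ, AnalyticAt ℝ x ξ) ∧
  (∀ ξ h : ℝ,
    HasSum (fun j : ℕ => iteratedDeriv j x ξ / (Nat.factorial j : ℝ) * h ^ j) (x (ξ + h))) ∧
  (∃ p₀ : ℝ, 0 < p₀ ∧ ∀ h : ℝ, p₀ ≤ deriv x h)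

/-- The power `u ↦ u ^ (-s)` is Lipschitz on `[c, ∞)` with constant `s * c ^ (-s - 1)`. -/
lemma abs_rpow_neg_sub_rpow_neg_le {s c u v : ℝ} (hs : 0 < s) (hc : 0 < c) (hu : c ≤ u)
    (hv : c ≤ v) : |u ^ (-s) - v ^ (-s)| ≤ s * c ^ (-s - 1) * |u - v| := by
  refine Convex.norm_image_sub_le_of_norm_hasDerivWithin_le (𝕜 := ℝ) (s := Set.Ici c)
    (f := fun w : ℝ => w ^ (-s)) (f' := fun w => -s * w ^ (-s - 1)) ?_ ?_ (convex_Ici c) hv hu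
  · intro w hw
    exact (Real.hasDerivAt_rpow_const (Or.inl (hc.trans_le hw).ne')).hasDerivWithinAt
  · intro w hw
    have hw0 : 0 < w := hc.trans_le hw
    rw [norm_mul, norm_neg, Real.norm_of_nonneg hs.le, Real.norm_of_nonneg (by positivity)]
    exact mul_le_mul_of_nonneg_left (Real.rpow_le_rpow_of_nonpos hc hw (by linarith)) hs.le

/-- Near `0` and near infinity, `min (t ^ 2) 1 * t ^ (-s)` vanishes for `0 < s < 2`. -/
lemma tendsto_min_sq_one_mul_rpow_neg {s : ℝ} (hs : 0 < s) (hs2 : s < 2) :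
    Tendsto (fun t : ℝ => min (t ^ 2) 1 * t ^ (-s)) (𝓝[>] 0) (𝓝 0) ∧
      Tendsto (fun t : ℝ => min (t ^ 2) 1 * t ^ (-s)) atTop (𝓝 0) := by
  constructor
  · have h : Tendsto (fun t : ℝ => t ^ (2 - s)) (𝓝[>] 0) (𝓝 0) := by
      have := (Real.continuousAt_rpow_const 0 (2 - s) (Or.inr (by linarith))).tendsto
      rw [Real.zero_rpow (by linarith)] at this
      exact this.mono_left nhdsWithin_le_nhds
    refine squeeze_zero' ?_ ?_ h
    · filter_upwards [self_mem_nhdsWithin] with t ht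
      have : (0 : ℝ) < t := ht
      positivity
    · filter_upwards [self_mem_nhdsWithin] with t ht
      have ht0 : (0 : ℝ) < t := ht
      rw [show 2 - s = 2 + -s by ring, Real.rpow_add ht0, Real.rpow_two]
      gcongr
      exact min_le_left _ _
  · refine squeeze_zero' ?_ ?_ (tendsto_rpow_neg_atTop hs)
    · filter_upwards [eventually_gt_atTop 0] with t ht
      positivity
    · filter_upwards [eventually_gt_atTop 0] with t ht
      have : 0 ≤ t ^ (-s) := by positivity
      exact mul_le_of_le_one_left this (min_le_right _ _)

lemma integrableOn_rpow_neg_sub_rpow_neg {f g : ℝ → ℝ} {p K s : ℝ} (hs : 0 < s) (hs2 : s < 2)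
    (hp : 0 < p) (hfc : Continuous f) (hgc : Continuous g)
    (hf : ∀ t, 0 < t → p * t ≤ f t) (hg : ∀ t, 0 < t → p * t ≤ g t)
    (hfg : ∀ t, 0 < t → |f t - g t| ≤ K * min (t ^ 2) 1) :
    IntegrableOn (fun t => f t ^ (-s) - g t ^ (-s)) (Set.Ioi 0) := by
  have hcont : ContinuousOn (fun t => f t ^ (-s) - g t ^ (-s)) (Set.Ioi 0) := by
    refine (hfc.continuousOn.rpow_const fun t ht => Or.inl ?_).sub
      (hgc.continuousOn.rpow_const fun t ht => Or.inl ?_)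
    · exact ((mul_pos hp ht).trans_le (hf t ht)).ne'
    · exact ((mul_pos hp ht).trans_le (hg t ht)).ne'
  have hmeas := hcont.aestronglyMeasurable (μ := volume) measurableSet_Ioi
  have hbound : ∀ t : ℝ, 0 < t → ‖f t ^ (-s) - g t ^ (-s)‖ ≤
      s * p ^ (-s - 1) * K * (min (t ^ 2) 1 * t ^ (-s - 1)) := by
    intro t ht
    refine (abs_rpow_neg_sub_rpow_neg_le hs (mul_pos hp ht) (hf t ht) (hg t ht)).trans ?_
    rw [Real.mul_rpow hp.le ht.le]
    refine (mul_le_mul_of_nonneg_left (hfg t ht) (by positivity)).trans_eq (by ring)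
  have hK : 0 ≤ K := by simpa using (abs_nonneg _).trans (hfg 1 one_pos)
  rw [← Set.Ioc_union_Ioi_eq_Ioi zero_le_one, integrableOn_union]
  constructor
  · have h := (intervalIntegrable_iff_integrableOn_Ioc_of_le zero_le_one).1
      (intervalIntegral.intervalIntegrable_rpow' (a := 0) (b := 1) (r := 1 - s) (by linarith))
    refine Integrable.mono' (h.const_mul (s * p ^ (-s - 1) * K))
      (hmeas.mono_set Set.Ioc_subset_Ioi_self) ?_
    filter_upwards [ae_restrict_mem measurableSet_Ioc] with t ht
    have ht0 := ht.1
    refine (hbound t ht0).trans ?_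
    rw [show 1 - s = 2 + (-s - 1) by ring, Real.rpow_add ht0, Real.rpow_two]
    gcongr
    exact min_le_left _ _
  · have h := integrableOn_Ioi_rpow_of_lt (a := -s - 1) (by linarith) one_pos
    refine Integrable.mono' (h.const_mul (s * p ^ (-s - 1) * K))
      (hmeas.mono_set (Set.Ioi_subset_Ioi zero_le_one)) ?_
    filter_upwards [ae_restrict_mem measurableSet_Ioi] with t ht
    have ht0 : (0 : ℝ) < t := zero_lt_one.trans ht
    refine (hbound t ht0).trans ?_
    gcongr
    exact mul_le_of_le_one_left (by positivity) (min_le_right _ _)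

lemma tendsto_intervalIntegral_of_integrableOn_Ioi {G : ℝ → ℝ}
    (hG : IntegrableOn G (Set.Ioi 0)) :
    Tendsto (fun p : ℝ × ℝ => ∫ t in p.1..p.2, G t) ((𝓝[>] 0) ×ˢ atTop)
      (𝓝 (∫ t in Set.Ioi 0, G t)) := by
  have hint : ∀ M : ℝ, 0 ≤ M → IntervalIntegrable G volume 0 M := fun M hM =>
    (intervalIntegrable_iff_integrableOn_Ioc_of_le hM).2 (hG.mono_set Set.Ioc_subset_Ioi_self)
  have h0 : Tendsto (fun δ => ∫ t in (0 : ℝ)..δ, G t) (𝓝[>] 0) (𝓝 0) := by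
    have hc := intervalIntegral.continuousOn_primitive_interval (f := G) (μ := volume)
      (a := 0) (b := 1) (by
        rw [Set.uIcc_of_le zero_le_one, integrableOn_Icc_iff_integrableOn_Ioc]
        exact hG.mono_set Set.Ioc_subset_Ioi_self)
    have := hc 0 Set.left_mem_uIcc
    rw [Set.uIcc_of_le zero_le_one, ContinuousWithinAt, intervalIntegral.integral_same] at this
    refine this.mono_left ?_
    rw [← nhdsWithin_Ioc_eq_nhdsGT (zero_lt_one' ℝ)]
    exact nhdsWithin_mono _ Set.Ioc_subset_Icc_self
  have h1 := intervalIntegral_tendsto_integral_Ioi 0 hG tendsto_id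
  have h := (h1.comp (tendsto_snd (f := 𝓝[>] (0 : ℝ)))).sub (h0.comp tendsto_fst)
  rw [sub_zero] at h
  refine h.congr' ?_
  filter_upwards [(eventually_mem_nhdsWithin (a := (0 : ℝ)) (s := Set.Ioi 0)).prod_mk
    (eventually_ge_atTop (0 : ℝ))] with q hq
  exact intervalIntegral.integral_interval_sub_left (hint _ hq.2) (hint _ (le_of_lt hq.1))

/-- If `f` and `g` grow at least linearly and are close to each other, then the level sets
`f a = g b` are close, and the integral of `g ^ (-s)` between them is small. -/
lemma abs_integral_rpow_neg_le_of_eq {f g : ℝ → ℝ} {p K s a b : ℝ} (hs : 0 < s) (hp : 0 < p)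
    (hf : ∀ t u, t ≤ u → p * (u - t) ≤ f u - f t)
    (hg : ∀ t u, t ≤ u → p * (u - t) ≤ g u - g t) (hg0 : g 0 = 0)
    (hfg : ∀ t, 0 < t → |f t - g t| ≤ K * min (t ^ 2) 1)
    (ha : 0 < a) (hb : 0 < b) (hab : f a = g b) :
    |∫ t in a..b, g t ^ (-s)| ≤
      K * p ^ (-s - 1) * (min (min a b ^ 2) 1 * min a b ^ (-s)) := by
  have hmin : 0 < min a b := lt_min ha hb
  have hdist : p * |b - a| ≤ K * min (min a b ^ 2) 1 := by
    rcases le_total a b with h | h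
    · rw [min_eq_left h, abs_of_nonneg (sub_nonneg.2 h)]
      exact (hg a b h).trans (by rw [← hab]; exact (le_abs_self _).trans (hfg a ha))
    · rw [min_eq_right h, abs_sub_comm, abs_of_nonneg (sub_nonneg.2 h)]
      refine (hf b a h).trans ?_
      rw [hab, ← neg_sub]
      exact (neg_le_abs _).trans (hfg b hb)
  have hint : |∫ t in a..b, g t ^ (-s)| ≤ (p * min a b) ^ (-s) * |b - a| := by
    refine intervalIntegral.norm_integral_le_of_norm_le_const (E := ℝ) fun t ht => ?_
    have ht0 : min a b ≤ t := ht.1.le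
    have hgt : p * min a b ≤ g t := by
      have := hg 0 t (hmin.le.trans ht0)
      rw [hg0, sub_zero, sub_zero] at this
      exact (mul_le_mul_of_nonneg_left ht0 hp.le).trans this
    have hpm : 0 < p * min a b := mul_pos hp hmin
    rw [Real.norm_of_nonneg (Real.rpow_nonneg (hpm.le.trans hgt) _)]
    exact Real.rpow_le_rpow_of_nonpos hpm hgt (by linarith)
  refine hint.trans ?_
  rw [Real.mul_rpow hp.le hmin.le, Real.rpow_sub_one hp.ne']
  have : |b - a| ≤ K * min (min a b ^ 2) 1 / p := by
    rw [le_div_iff₀ hp, mul_comm]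
    exact hdist
  refine (mul_le_mul_of_nonneg_left this (by positivity)).trans_eq (by ring)

/-- The second symmetric difference of a `C²` function is quadratically small on `[0, 1]`. -/
lemma exists_abs_symmetric_difference_le {x : ℝ → ℝ} (hx : ContDiff ℝ 2 x) (ξ : ℝ) :
    ∃ L : ℝ, ∀ t, 0 ≤ t → t ≤ 1 → |x (ξ + t) + x (ξ - t) - 2 * x ξ| ≤ L * t ^ 2 := by
  have hd : Differentiable ℝ x := hx.differentiable (by norm_num)
  have hx' : ContDiff ℝ 1 (deriv x) := ((contDiff_succ_iff_deriv (n := 1)).1 hx).2.2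
  have hd' : Differentiable ℝ (deriv x) := hx'.differentiable (by norm_num)
  obtain ⟨L, hL⟩ := (isCompact_Icc (a := ξ - 1) (b := ξ + 1)).exists_bound_of_continuousOn
    (hx'.continuous_deriv le_rfl).continuousOn
  refine ⟨2 * L, fun t ht0 ht1 => ?_⟩
  have hL0 : 0 ≤ L := (norm_nonneg _).trans (hL ξ ⟨by linarith, by linarith⟩)
  have key := (convex_Icc (0 : ℝ) t).norm_image_sub_le_of_norm_hasDerivWithin_le
    (f := fun u => x (ξ + u) + x (ξ - u))
    (f' := fun u => deriv x (ξ + u) - deriv x (ξ - u)) (C := 2 * L * t) (x := 0) (y := t)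
    (fun u _ => by
      have h1 := (hd (ξ + u)).hasDerivAt.comp_const_add ξ u
      have h2 := (hd (ξ - u)).hasDerivAt.comp_const_sub ξ u
      exact ((h1.add h2).congr_deriv (by ring)).hasDerivWithinAt)
    (fun u hu => by
      have h := (convex_Icc (ξ - 1) (ξ + 1)).norm_image_sub_le_of_norm_deriv_le
        (f := deriv x) (C := L) (x := ξ - u) (y := ξ + u) (fun v _ => hd' v) hL
        ⟨by linarith [hu.2], by linarith [hu.1]⟩ ⟨by linarith [hu.1], by linarith [hu.2]⟩
      refine h.trans ?_
      rw [show ξ + u - (ξ - u) = 2 * u by ring, Real.norm_of_nonneg (by linarith [hu.1])]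
      nlinarith [hu.2])
    ⟨le_rfl, ht0⟩ ⟨ht0, le_rfl⟩
  simp only [add_zero, sub_zero, Real.norm_eq_abs, abs_of_nonneg ht0] at key
  rw [show x (ξ + t) + x (ξ - t) - 2 * x ξ = x (ξ + t) + x (ξ - t) - (x ξ + x ξ) by ring]
  exact key.trans_eq (by ring)

/-- A surface at bounded distance from a line has symmetric differences that are both bounded and
quadratically small. -/
lemma exists_abs_symmetric_difference_le_min {x : ℝ → ℝ} (hx : ContDiff ℝ 2 x) {A C : ℝ}
    (hbd : ∀ h : ℝ, |x h - h / A| ≤ C) (ξ : ℝ) :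
    ∃ K : ℝ, ∀ t, 0 < t → |x (ξ + t) + x (ξ - t) - 2 * x ξ| ≤ K * min (t ^ 2) 1 := by
  obtain ⟨L, hL⟩ := exists_abs_symmetric_difference_le hx ξ
  refine ⟨max L (4 * C), fun t ht => ?_⟩
  rcases le_total t 1 with h | h
  · rw [min_eq_left (by nlinarith)]
    exact (hL t ht.le h).trans (mul_le_mul_of_nonneg_right (le_max_left _ _) (sq_nonneg t))
  · rw [min_eq_right (by nlinarith), mul_one]
    refine le_trans ?_ (le_max_right _ _)
    have h1 := abs_le.1 (hbd (ξ + t))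
    have h2 := abs_le.1 (hbd (ξ - t))
    have h3 := abs_le.1 (hbd ξ)
    rw [add_div] at h1
    rw [sub_div] at h2
    rw [abs_le]
    constructor <;> linarith

theorem stmt_2 (x : ℝ → ℝ) (hx : RegularSurface x)
    (A : ℝ) (hA : 0 < A) (hbd : ∃ C : ℝ, ∀ h : ℝ, |x h - h / A| ≤ C)
    (m : ℝ) (hm : -1 < m) (hm' : m < 1) (ξ : ℝ)
    (hinv : ℝ → ℝ) (hinv_left : ∀ t : ℝ, hinv (x t) = t)
    (hinv_right : ∀ y : ℝ, x (hinv y) = y) :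
    ∃ I : ℝ,
      Tendsto (fun p : ℝ × ℝ => ∫ t in p.1..p.2, Gfun x m ξ t)
        ((𝓝[>] (0 : ℝ)) ×ˢ (atTop : Filter ℝ)) (𝓝 I) ∧
      Tendsto (fun p : ℝ × ℝ =>
          (∫ y in (x ξ + p.1)..(x ξ + p.2), deriv hinv y * (y - x ξ) ^ (-(m + 1))) -
            ∫ y in (x ξ - p.2)..(x ξ - p.1), deriv hinv y * (x ξ - y) ^ (-(m + 1)))
        ((𝓝[>] (0 : ℝ)) ×ˢ (atTop : Filter ℝ)) (𝓝 I) := by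
  obtain ⟨han, -, p, hp, hder⟩ := hx
  obtain ⟨C, hC⟩ := hbd
  have hs : 0 < m + 1 := by linarith
  have hs2 : m + 1 < 2 := by linarith
  have hcd : ContDiff ℝ 2 x := contDiff_iff_contDiffAt.2 fun t => (han t).contDiffAt
  have hd : Differentiable ℝ x := hcd.differentiable (by norm_num)
  have hxc : Continuous x := hd.continuous
  have hgrow : ∀ t u, t ≤ u → p * (u - t) ≤ x u - x t :=
    fun t u h => mul_sub_le_image_sub_of_le_deriv hd hder h
  have hmono : StrictMono x := strictMono_of_deriv_pos fun t => hp.trans_le (hder t)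
  have hinv_lt : ∀ {y t : ℝ}, hinv y < t ↔ y < x t := fun {y t} => by
    rw [← hmono.lt_iff_lt, hinv_right]
  have lt_hinv : ∀ {y t : ℝ}, t < hinv y ↔ x t < y := fun {y t} => by
    rw [← hmono.lt_iff_lt, hinv_right]
  have hinv_mono : StrictMono hinv := fun y z h => by rwa [hinv_lt, hinv_right]
  have hinv_cont : Continuous hinv :=
    hinv_mono.monotone.continuous_of_surjective fun t => ⟨x t, hinv_left t⟩
  have hinv_der : ∀ y, HasDerivAt hinv (deriv x (hinv y))⁻¹ y := fun y =>
    (hd (hinv y)).hasDerivAt.of_local_left_inverse hinv_cont.continuousAt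
      (hp.trans_le (hder _)).ne' (Eventually.of_forall hinv_right)
  have hderiv : deriv hinv = fun y => (deriv x (hinv y))⁻¹ := funext fun y => (hinv_der y).deriv
  have hderiv_cont : Continuous (deriv hinv) := by
    rw [hderiv]
    exact ((hcd.continuous_deriv (by norm_num)).comp hinv_cont).inv₀
      fun y => (hp.trans_le (hder _)).ne'
  obtain ⟨K, hK⟩ := exists_abs_symmetric_difference_le_min hcd hC ξ
  set f : ℝ → ℝ := fun t => x (ξ + t) - x ξ with hf_def
  set g : ℝ → ℝ := fun t => x ξ - x (ξ - t) with hg_def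
  have hfc : Continuous f := by fun_prop
  have hgc : Continuous g := by fun_prop
  have hf : ∀ t u, t ≤ u → p * (u - t) ≤ f u - f t := fun t u h => by
    have := hgrow (ξ + t) (ξ + u) (by linarith)
    simp only [hf_def]; linarith
  have hg : ∀ t u, t ≤ u → p * (u - t) ≤ g u - g t := fun t u h => by
    have := hgrow (ξ - u) (ξ - t) (by linarith)
    simp only [hg_def]; linarith
  have hf0 : f 0 = 0 := by simp [hf_def]
  have hg0 : g 0 = 0 := by simp [hg_def]
  have hf' : ∀ t, 0 < t → p * t ≤ f t := fun t ht => by simpa [hf0] using hf 0 t ht.le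
  have hg' : ∀ t, 0 < t → p * t ≤ g t := fun t ht => by simpa [hg0] using hg 0 t ht.le
  have hfg : ∀ t, 0 < t → |f t - g t| ≤ K * min (t ^ 2) 1 := fun t ht => by
    have : f t - g t = x (ξ + t) + x (ξ - t) - 2 * x ξ := by simp only [hf_def, hg_def]; ring
    rw [this]
    exact hK t ht
  have hG := integrableOn_rpow_neg_sub_rpow_neg hs hs2 hp hfc hgc hf' hg' hfg
  have hlim := tendsto_intervalIntegral_of_integrableOn_Ioi hG
  refine ⟨_, hlim, ?_⟩
  -- `α` and `β` are the inverse functions of `f` and `g`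
  set α : ℝ → ℝ := fun δ => hinv (x ξ + δ) - ξ with hα_def
  set β : ℝ → ℝ := fun δ => ξ - hinv (x ξ - δ) with hβ_def
  have hfα : ∀ δ, f (α δ) = δ := fun δ => by simp [hf_def, hα_def, hinv_right]
  have hgβ : ∀ δ, g (β δ) = δ := fun δ => by simp [hg_def, hβ_def, hinv_right]
  have hαpos : ∀ δ, 0 < δ → 0 < α δ := fun δ hδ => sub_pos.2 (lt_hinv.2 (by linarith))
  have hβpos : ∀ δ, 0 < δ → 0 < β δ := fun δ hδ => sub_pos.2 (hinv_lt.2 (by linarith))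
  have hα0 : Tendsto α (𝓝[>] 0) (𝓝[>] 0) := by
    refine tendsto_nhdsWithin_iff.2 ⟨?_, eventually_mem_nhdsWithin.mono hαpos⟩
    have : Continuous α := by fun_prop
    simpa [hα_def, hinv_left] using (this.tendsto 0).mono_left nhdsWithin_le_nhds
  have hβ0 : Tendsto β (𝓝[>] 0) (𝓝[>] 0) := by
    refine tendsto_nhdsWithin_iff.2 ⟨?_, eventually_mem_nhdsWithin.mono hβpos⟩
    have : Continuous β := by fun_prop
    simpa [hβ_def, hinv_left] using (this.tendsto 0).mono_left nhdsWithin_le_nhds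
  have hαtop : Tendsto α atTop atTop := tendsto_atTop.2 fun b => by
    filter_upwards [eventually_gt_atTop (f b)] with M hM
    have : ξ + b < hinv (x ξ + M) := lt_hinv.2 (by simp only [hf_def] at hM; linarith)
    simp only [hα_def]; linarith
  have hβtop : Tendsto β atTop atTop := tendsto_atTop.2 fun b => by
    filter_upwards [eventually_gt_atTop (g b)] with M hM
    have : hinv (x ξ - M) < ξ - b := hinv_lt.2 (by simp only [hg_def] at hM; linarith)
    simp only [hβ_def]; linarith
  have hmin0 : Tendsto (fun δ => min (α δ) (β δ)) (𝓝[>] 0) (𝓝[>] 0) := by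
    refine tendsto_nhdsWithin_iff.2 ⟨?_, eventually_mem_nhdsWithin.mono fun δ hδ =>
      lt_min (hαpos δ hδ) (hβpos δ hδ)⟩
    simpa using (hα0.mono_right nhdsWithin_le_nhds).min (hβ0.mono_right nhdsWithin_le_nhds)
  have hmintop : Tendsto (fun M => min (α M) (β M)) atTop atTop :=
    tendsto_atTop.2 fun b => by
      filter_upwards [tendsto_atTop.1 hαtop b, tendsto_atTop.1 hβtop b] with M h1 h2
      exact le_min h1 h2
  have hend : ∀ l : Filter ℝ, (∀ᶠ δ in l, 0 < δ) →
      Tendsto (fun δ => min (min (α δ) (β δ) ^ 2) 1 * min (α δ) (β δ) ^ (-(m + 1))) l (𝓝 0) →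
      Tendsto (fun δ => ∫ t in (α δ)..(β δ), g t ^ (-(m + 1))) l (𝓝 0) := fun l hl h => by
    refine squeeze_zero_norm' ?_ (mul_zero (K * p ^ (-(m + 1) - 1)) ▸ h.const_mul _)
    filter_upwards [hl] with δ hδ
    exact abs_integral_rpow_neg_le_of_eq hs hp hf hg hg0 hfg (hαpos δ hδ) (hβpos δ hδ)
      ((hfα δ).trans (hgβ δ).symm)
  obtain ⟨hz, hi⟩ := tendsto_min_sq_one_mul_rpow_neg hs hs2
  have hend0 := hend _ eventually_mem_nhdsWithin (hz.comp hmin0)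
  have hendtop := hend _ (eventually_gt_atTop 0) (hi.comp hmintop)
  have hmain := ((hlim.comp (hα0.prodMap hαtop)).add (hend0.comp tendsto_fst)).sub
    (hendtop.comp tendsto_snd)
  rw [add_zero, sub_zero] at hmain
  refine hmain.congr' ?_
  filter_upwards [(eventually_mem_nhdsWithin (a := (0 : ℝ)) (s := Set.Ioi 0)).prod_mk
    (eventually_gt_atTop (0 : ℝ))] with ⟨δ, M⟩ hq
  obtain ⟨hδ, hM⟩ : 0 < δ ∧ 0 < M := hq
  have hfp : ContinuousOn (fun t => f t ^ (-(m + 1))) (Set.Ioi 0) :=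
    hfc.continuousOn.rpow_const fun t ht => Or.inl ((mul_pos hp ht).trans_le (hf' t ht)).ne'
  have hgp : ContinuousOn (fun t => g t ^ (-(m + 1))) (Set.Ioi 0) :=
    hgc.continuousOn.rpow_const fun t ht => Or.inl ((mul_pos hp ht).trans_le (hg' t ht)).ne'
  have hint : ∀ {F : ℝ → ℝ} {a b : ℝ}, ContinuousOn F (Set.Ioi 0) → 0 < a → 0 < b →
      IntervalIntegrable F volume a b := fun hF ha hb =>
    (hF.mono fun t ht => (lt_min ha hb).trans_le ht.1).intervalIntegrable
  have hsub1 : ∫ y in (x ξ + δ)..(x ξ + M), deriv hinv y * (y - x ξ) ^ (-(m + 1)) =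
      ∫ t in (α δ)..(α M), f t ^ (-(m + 1)) := by
    have h := intervalIntegral.integral_comp_mul_deriv' (a := δ) (b := M) (f := α)
      (f' := fun u => deriv hinv (x ξ + u)) (g := fun t => f t ^ (-(m + 1)))
      (fun u _ => by
        have := (hinv_der (x ξ + u)).differentiableAt.hasDerivAt
        exact (this.comp_const_add (x ξ) u).sub_const ξ)
      (hderiv_cont.comp (continuous_const.add continuous_id)).continuousOn
      (hfp.mono (by
        rintro _ ⟨u, hu, rfl⟩
        exact hαpos u ((lt_min hδ hM).trans_le hu.1)))
    rw [← h, ← intervalIntegral.integral_comp_add_left]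
    refine intervalIntegral.integral_congr fun u _ => ?_
    simp only [Function.comp_apply, hfα]
    rw [add_sub_cancel_left, mul_comm]
  have hsub2 : ∫ y in (x ξ - M)..(x ξ - δ), deriv hinv y * (x ξ - y) ^ (-(m + 1)) =
      ∫ t in (β δ)..(β M), g t ^ (-(m + 1)) := by
    have h := intervalIntegral.integral_comp_mul_deriv' (a := δ) (b := M) (f := β)
      (f' := fun u => deriv hinv (x ξ - u)) (g := fun t => g t ^ (-(m + 1)))
      (fun u _ => by
        have := (hinv_der (x ξ - u)).differentiableAt.hasDerivAt
        simpa using (this.comp_const_sub (x ξ) u).const_sub ξ)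
      (hderiv_cont.comp (continuous_const.sub continuous_id)).continuousOn
      (hgp.mono (by
        rintro _ ⟨u, hu, rfl⟩
        exact hβpos u ((lt_min hδ hM).trans_le hu.1)))
    rw [← h, ← intervalIntegral.integral_comp_sub_left]
    refine intervalIntegral.integral_congr fun u _ => ?_
    simp only [Function.comp_apply, hgβ]
    rw [sub_sub_cancel, mul_comm]
  have hαδ := hαpos δ hδ
  have hαM := hαpos M hM
  have hβδ := hβpos δ hδ
  have hβM := hβpos M hM
  have e1 := intervalIntegral.integral_sub (hint hfp hαδ hαM) (hint hgp hαδ hαM)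
  have e2 := intervalIntegral.integral_add_adjacent_intervals (hint hgp hαδ hβδ)
    (hint hgp hβδ hβM)
  have e3 := intervalIntegral.integral_add_adjacent_intervals (hint hgp hαδ hαM)
    (hint hgp hαM hβM)
  simp only [Function.comp_apply, Prod.map_apply]
  rw [hsub1, hsub2, e1]
  linarith
end

section
/- Let −1 < m < 1 and let f : ℝ → ℝ be a Schwartz function. Then for every x ∈ ℝ both principal values P.V. ∫_ℝ (x−y) f'(y) |x−y|^{−(m+2)} dy and P.V. ∫_ℝ (f(x) − f(y)) |x−y|^{−(m+2)} dy exist (as iterated limits over {y : δ ≤ |x−y| ≤ M}, δ → 0⁺, M → +∞), and P.V. ∫_ℝ (x−y) f'(y) |x−y|^{−(m+2)} dy = (m+1) · P.V. ∫_ℝ (f(x) − f(y)) |x−y|^{−(m+2)} dy. In particular, for m = 0, (1/π) P.V. ∫_ℝ (f(x) − f(y)) |x−y|^{−2} dy = (1/π) P.V. ∫_ℝ f'(y)/(x−y) dy, i.e. it equals the Hilbert transform of f' evaluated at x. -/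
open Real Filter Topology MeasureTheory

/-- Folding the integral over a symmetric annulus around `x` onto an interval of radii. -/
theorem setIntegral_annulus_eq (φ : ℝ → ℝ) (x : ℝ) (hφ : ContinuousOn φ {x}ᶜ) {δ M : ℝ}
    (hδ : 0 < δ) (hM : δ ≤ M) :
    ∫ y in {y : ℝ | δ ≤ |x - y| ∧ |x - y| ≤ M}, φ y = ∫ t in δ..M, (φ (x + t) + φ (x - t)) := by
  have hset : {y : ℝ | δ ≤ |x - y| ∧ |x - y| ≤ M} =
      Set.Icc (x + δ) (x + M) ∪ Set.Icc (x - M) (x - δ) := by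
    ext y
    simp only [Set.mem_ofPred_eq, Set.mem_union, Set.mem_Icc]
    rcases abs_cases (x - y) with ⟨h, h'⟩ | ⟨h, h'⟩ <;> rw [h] <;> constructor
    · rintro ⟨_, _⟩; right; constructor <;> linarith
    · rintro (⟨_, _⟩ | ⟨_, _⟩) <;> constructor <;> linarith
    · rintro ⟨_, _⟩; left; constructor <;> linarith
    · rintro (⟨_, _⟩ | ⟨_, _⟩) <;> constructor <;> linarith
  have hdisj : Disjoint (Set.Icc (x + δ) (x + M)) (Set.Icc (x - M) (x - δ)) := by
    rw [Set.disjoint_left]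
    rintro y ⟨h1, _⟩ ⟨_, h2⟩
    linarith
  have hright : ContinuousOn φ (Set.Icc (x + δ) (x + M)) := by
    refine hφ.mono fun y hy => ?_
    simp only [Set.mem_compl_iff, Set.mem_singleton_iff]
    rintro rfl
    linarith [hy.1]
  have hleft : ContinuousOn φ (Set.Icc (x - M) (x - δ)) := by
    refine hφ.mono fun y hy => ?_
    simp only [Set.mem_compl_iff, Set.mem_singleton_iff]
    rintro rfl
    linarith [hy.2]
  have hright' : IntervalIntegrable (fun t => φ (x + t)) volume δ M := by
    apply ContinuousOn.intervalIntegrable_of_Icc hM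
    refine hright.comp (by fun_prop) fun t ht => ?_
    exact ⟨by linarith [ht.1], by linarith [ht.2]⟩
  have hleft' : IntervalIntegrable (fun t => φ (x - t)) volume δ M := by
    apply ContinuousOn.intervalIntegrable_of_Icc hM
    refine hleft.comp (by fun_prop) fun t ht => ?_
    exact ⟨by linarith [ht.2], by linarith [ht.1]⟩
  rw [hset, setIntegral_union hdisj measurableSet_Icc hright.integrableOn_Icc
    hleft.integrableOn_Icc, integral_Icc_eq_integral_Ioc, integral_Icc_eq_integral_Ioc,
    ← intervalIntegral.integral_of_le (by linarith), ← intervalIntegral.integral_of_le (by linarith),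
    intervalIntegral.integral_add hright' hleft', intervalIntegral.integral_comp_add_left,
    intervalIntegral.integral_comp_sub_left]

/-- A function that is integrable on `(0, ∞)` has truncated integrals converging jointly in both
cutoffs. -/
theorem tendsto_intervalIntegral_zero_atTop {h : ℝ → ℝ} (hh : IntegrableOn h (Set.Ioi 0)) :
    Tendsto (fun p : ℝ × ℝ => ∫ t in p.1..p.2, h t) ((𝓝[>] (0 : ℝ)) ×ˢ (atTop : Filter ℝ))
      (𝓝 (∫ t in Set.Ioi 0, h t)) := by
  have hI : ∀ b : ℝ, 0 ≤ b → IntervalIntegrable h volume 0 b := fun b hb => by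
    rw [intervalIntegrable_iff_integrableOn_Ioc_of_le hb]
    exact hh.mono_set Set.Ioc_subset_Ioi_self
  have h1 : Tendsto (fun b => ∫ t in (0 : ℝ)..b, h t) atTop (𝓝 (∫ t in Set.Ioi 0, h t)) :=
    intervalIntegral_tendsto_integral_Ioi 0 hh tendsto_id
  have h2 : Tendsto (fun b => ∫ t in (0 : ℝ)..b, h t) (𝓝[>] 0) (𝓝 0) := by
    have hc : ContinuousOn (fun b => ∫ t in (0 : ℝ)..b, h t) (Set.uIcc 0 1) := by
      refine intervalIntegral.continuousOn_primitive_interval ?_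
      rw [Set.uIcc_of_le zero_le_one, integrableOn_Icc_iff_integrableOn_Ioc]
      exact hh.mono_set Set.Ioc_subset_Ioi_self
    have hle : 𝓝[>] (0 : ℝ) ≤ 𝓝[Set.uIcc 0 1] 0 := by
      rw [nhdsWithin_le_iff, Set.uIcc_of_le zero_le_one]
      exact mem_of_superset (Ioc_mem_nhdsGT one_pos) Set.Ioc_subset_Icc_self
    simpa using (hc 0 Set.left_mem_uIcc).tendsto.mono_left hle
  have h3 := (h1.comp (tendsto_snd (f := 𝓝[>] (0 : ℝ)))).sub
    (h2.comp (tendsto_fst (g := (atTop : Filter ℝ))))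
  rw [sub_zero] at h3
  refine h3.congr' ?_
  have : ∀ᶠ p : ℝ × ℝ in (𝓝[>] (0 : ℝ)) ×ˢ (atTop : Filter ℝ), 0 < p.1 ∧ 0 ≤ p.2 :=
    (eventually_mem_nhdsWithin (a := (0 : ℝ)) (s := Set.Ioi 0)).prod_mk (eventually_ge_atTop 0)
  filter_upwards [this] with p hp
  exact intervalIntegral.integral_interval_sub_left (hI _ hp.2) (hI _ hp.1.le)

/-- Integrability of `g t * t ^ (-s)` on `(0, ∞)` for bounded `g` vanishing quadratically at `0`. -/
theorem integrableOn_Ioi_mul_rpow_neg {g : ℝ → ℝ} (hg : Continuous g) {s B C : ℝ} (hs : 1 < s)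
    (hs' : s < 3) (hB : ∀ t, |g t| ≤ B) (hC : ∀ t, 0 ≤ t → |g t| ≤ C * t ^ 2) :
    IntegrableOn (fun t => g t * t ^ (-s)) (Set.Ioi 0) := by
  have hm : Measurable fun t : ℝ => g t * t ^ (-s) :=
    hg.measurable.mul (measurable_id.pow_const _)
  rw [← Set.Ioc_union_Ioi_eq_Ioi (zero_le_one (α := ℝ))]
  refine IntegrableOn.union ?_ ?_
  · have h1 : IntegrableOn (fun t : ℝ => C * t ^ (2 - s)) (Set.Ioc 0 1) := by
      refine Integrable.const_mul ?_ C
      exact (intervalIntegrable_iff_integrableOn_Ioc_of_le zero_le_one).1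
        (intervalIntegral.intervalIntegrable_rpow' (by linarith))
    refine Integrable.mono' h1 hm.aestronglyMeasurable ?_
    filter_upwards [ae_restrict_mem measurableSet_Ioc] with t ht
    have hp := rpow_nonneg ht.1.le (-s)
    rw [norm_mul, norm_eq_abs, norm_of_nonneg hp, sub_eq_add_neg, rpow_add ht.1, rpow_two,
      ← mul_assoc]
    exact mul_le_mul_of_nonneg_right (hC t ht.1.le) hp
  · have h1 : IntegrableOn (fun t : ℝ => B * t ^ (-s)) (Set.Ioi 1) :=
      (integrableOn_Ioi_rpow_of_lt (by linarith) one_pos).const_mul B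
    refine Integrable.mono' h1 hm.aestronglyMeasurable ?_
    filter_upwards [ae_restrict_mem measurableSet_Ioi] with t ht
    have hp := rpow_nonneg (zero_le_one.trans (le_of_lt ht)) (-s)
    rw [norm_mul, norm_eq_abs, norm_of_nonneg hp]
    exact mul_le_mul_of_nonneg_right (hB t) hp

theorem SchwartzMap.exists_abs_le (f : SchwartzMap ℝ ℝ) : ∃ C, ∀ y, |f y| ≤ C := by
  obtain ⟨C, _, hC⟩ := f.decay 0 0
  exact ⟨C, fun y => by simpa using hC y⟩

theorem SchwartzMap.exists_abs_deriv_sub_le (f : SchwartzMap ℝ ℝ) :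
    ∃ K, 0 ≤ K ∧ ∀ y z, |deriv f y - deriv f z| ≤ K * |y - z| := by
  set f' := SchwartzMap.derivCLM ℝ ℝ f
  obtain ⟨K, hK⟩ := (SchwartzMap.derivCLM ℝ ℝ f').exists_abs_le
  refine ⟨K, (abs_nonneg _).trans (hK 0), fun y z => ?_⟩
  exact convex_univ.norm_image_sub_le_of_norm_deriv_le (f := f') (fun w _ => f'.differentiableAt)
    (fun w _ => hK w) (Set.mem_univ z) (Set.mem_univ y)

/-- The negative symmetric second difference of a Schwartz function is quadratically small. -/
theorem SchwartzMap.exists_abs_second_difference_le (f : SchwartzMap ℝ ℝ) (x : ℝ) :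
    ∃ C, ∀ t, 0 ≤ t → |2 * f x - f (x + t) - f (x - t)| ≤ C * t ^ 2 := by
  obtain ⟨K, hK0, hK⟩ := f.exists_abs_deriv_sub_le
  refine ⟨2 * K, fun t ht => ?_⟩
  have hd : ∀ u ∈ Set.Icc 0 t, HasDerivWithinAt (fun u => 2 * f x - f (x + u) - f (x - u))
      (deriv f (x - u) - deriv f (x + u)) (Set.Icc 0 t) u := fun u _ => by
    have h1 := (f.differentiableAt (x := x + u)).hasDerivAt.comp_const_add x u
    have h2 := (f.differentiableAt (x := x - u)).hasDerivAt.comp_const_sub x u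
    exact (((h1.const_sub (2 * f x)).sub h2).congr_deriv (by ring)).hasDerivWithinAt
  have := (convex_Icc 0 t).norm_image_sub_le_of_norm_hasDerivWithin_le hd (C := K * (2 * t))
    (fun u hu => (hK _ _).trans (by
      refine mul_le_mul_of_nonneg_left ?_ hK0
      rw [abs_le]; constructor <;> linarith [hu.1, hu.2]))
    (Set.left_mem_Icc.2 ht) (Set.right_mem_Icc.2 ht)
  simp only [norm_eq_abs, add_zero, sub_zero, abs_of_nonneg ht] at this
  calc |2 * f x - f (x + t) - f (x - t)|
      = |2 * f x - f (x + t) - f (x - t) - (2 * f x - f x - f x)| := by congr 1; ring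
    _ ≤ _ := this
    _ = _ := by ring

theorem stmt_4 (m : ℝ) (hm : -1 < m) (hm' : m < 1) (f : SchwartzMap ℝ ℝ) (x : ℝ) :
    ∃ L : ℝ,
      Tendsto (fun p : ℝ × ℝ =>
          ∫ y in {y : ℝ | p.1 ≤ |x - y| ∧ |x - y| ≤ p.2}, (f x - f y) * |x - y| ^ (-(m + 2)))
        ((𝓝[>] (0 : ℝ)) ×ˢ (atTop : Filter ℝ)) (𝓝 L) ∧
      Tendsto (fun p : ℝ × ℝ =>
          ∫ y in {y : ℝ | p.1 ≤ |x - y| ∧ |x - y| ≤ p.2},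
            (x - y) * deriv (f : ℝ → ℝ) y * |x - y| ^ (-(m + 2)))
        ((𝓝[>] (0 : ℝ)) ×ˢ (atTop : Filter ℝ)) (𝓝 ((m + 1) * L)) ∧
      (m = 0 →
        Tendsto (fun p : ℝ × ℝ =>
            (1 / π) * ∫ y in {y : ℝ | p.1 ≤ |x - y| ∧ |x - y| ≤ p.2}, deriv (f : ℝ → ℝ) y / (x - y))
          ((𝓝[>] (0 : ℝ)) ×ˢ (atTop : Filter ℝ)) (𝓝 ((1 / π) * L))) := by
  set g : ℝ → ℝ := fun t => 2 * f x - f (x + t) - f (x - t) with hg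
  have hfc : Continuous f := f.continuous
  have hdc : Continuous (deriv f) := (SchwartzMap.derivCLM ℝ ℝ f).continuous
  have hgc : Continuous g := by fun_prop
  have hgd : ∀ t, HasDerivAt g (deriv f (x - t) - deriv f (x + t)) t := fun u => by
    have h1 := (f.differentiableAt (x := x + u)).hasDerivAt.comp_const_add x u
    have h2 := (f.differentiableAt (x := x - u)).hasDerivAt.comp_const_sub x u
    exact ((h1.const_sub (2 * f x)).sub h2).congr_deriv (by ring)
  obtain ⟨C, hC⟩ := f.exists_abs_second_difference_le x
  obtain ⟨B, hB⟩ : ∃ B, ∀ t, |g t| ≤ B := by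
    obtain ⟨A, hA⟩ := f.exists_abs_le
    refine ⟨4 * A, fun t => ?_⟩
    have h1 := abs_le.1 (hA x)
    have h2 := abs_le.1 (hA (x + t))
    have h3 := abs_le.1 (hA (x - t))
    rw [abs_le]
    constructor <;> simp only [hg] <;> linarith [h1.1, h1.2, h2.1, h2.2, h3.1, h3.2]
  have hint : IntegrableOn (fun t => g t * t ^ (-(m + 2))) (Set.Ioi 0) :=
    integrableOn_Ioi_mul_rpow_neg hgc (by linarith) (by linarith) hB hC
  have hlim := tendsto_intervalIntegral_zero_atTop hint
  have hev : ∀ᶠ p : ℝ × ℝ in (𝓝[>] (0 : ℝ)) ×ˢ (atTop : Filter ℝ), 0 < p.1 ∧ p.1 ≤ p.2 := by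
    have : ∀ᶠ p : ℝ × ℝ in (𝓝[>] (0 : ℝ)) ×ˢ (atTop : Filter ℝ),
        p.1 ∈ Set.Ioc (0 : ℝ) 1 ∧ 1 ≤ p.2 :=
      (show ∀ᶠ d in 𝓝[>] (0 : ℝ), d ∈ Set.Ioc (0 : ℝ) 1 from Ioc_mem_nhdsGT one_pos).prod_mk
        (eventually_ge_atTop 1)
    filter_upwards [this] with p hp
    exact ⟨hp.1.1, hp.1.2.trans hp.2⟩
  have hpow : ContinuousOn (fun y : ℝ => |x - y| ^ (-(m + 2))) {x}ᶜ := by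
    refine ContinuousOn.rpow_const (by fun_prop) fun y hy => Or.inl ?_
    rw [abs_ne_zero, sub_ne_zero]
    exact fun h => hy h.symm
  have hsecond : Tendsto (fun p : ℝ × ℝ =>
      ∫ y in {y : ℝ | p.1 ≤ |x - y| ∧ |x - y| ≤ p.2},
        (x - y) * deriv (f : ℝ → ℝ) y * |x - y| ^ (-(m + 2)))
      ((𝓝[>] (0 : ℝ)) ×ˢ (atTop : Filter ℝ))
      (𝓝 ((m + 1) * ∫ t in Set.Ioi 0, g t * t ^ (-(m + 2)))) := by
    have htop : Tendsto (fun t => g t * t ^ (-(m + 1))) atTop (𝓝 0) := by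
      have h0 : Tendsto (fun t : ℝ => B * t ^ (-(m + 1))) atTop (𝓝 0) := by
        simpa using (tendsto_rpow_neg_atTop (by linarith : 0 < m + 1)).const_mul B
      refine squeeze_zero_norm' ?_ h0
      filter_upwards [eventually_ge_atTop 0] with t ht
      have hp := rpow_nonneg ht (-(m + 1))
      rw [norm_mul, norm_eq_abs, norm_of_nonneg hp]
      exact mul_le_mul_of_nonneg_right (hB t) hp
    have hzero : Tendsto (fun t => g t * t ^ (-(m + 1))) (𝓝[>] 0) (𝓝 0) := by
      have h0 : Tendsto (fun t : ℝ => C * t ^ (1 - m)) (𝓝[>] 0) (𝓝 0) := by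
        have := ((continuousAt_rpow_const (0 : ℝ) (1 - m) (Or.inr (by linarith))).tendsto.const_mul
          C).mono_left (nhdsWithin_le_nhds (s := Set.Ioi 0))
        rwa [zero_rpow (by linarith), mul_zero] at this
      refine squeeze_zero_norm' ?_ h0
      filter_upwards [self_mem_nhdsWithin] with t ht
      have ht : 0 < t := ht
      have hp := rpow_nonneg ht.le (-(m + 1))
      rw [norm_mul, norm_eq_abs, norm_of_nonneg hp, show 1 - m = 2 + -(m + 1) by ring,
        rpow_add ht, rpow_two, ← mul_assoc]
      exact mul_le_mul_of_nonneg_right (hC t ht.le) hp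
    have h := ((htop.comp (tendsto_snd (f := 𝓝[>] (0 : ℝ)))).sub
      (hzero.comp (tendsto_fst (g := (atTop : Filter ℝ))))).add (hlim.const_mul (m + 1))
    rw [sub_zero, zero_add] at h
    refine h.congr' ?_
    filter_upwards [hev] with p ⟨hp1, hp2⟩
    have hpos : ∀ t ∈ Set.uIcc p.1 p.2, 0 < t := fun t ht => by
      rw [Set.uIcc_of_le hp2] at ht
      exact hp1.trans_le ht.1
    have hrpow : ∀ r : ℝ, ContinuousOn (fun t : ℝ => t ^ r) (Set.uIcc p.1 p.2) := fun r =>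
      continuousOn_id.rpow_const fun t ht => Or.inl (hpos t ht).ne'
    rw [setIntegral_annulus_eq (fun y => (x - y) * deriv f y * |x - y| ^ (-(m + 2))) x
      (ContinuousOn.mul (by fun_prop) hpow) hp1 hp2]
    have hparts := intervalIntegral.integral_mul_deriv_eq_deriv_mul (a := p.1) (b := p.2)
      (u := fun t : ℝ => t ^ (-(m + 1))) (v := g) (u' := fun t => -(m + 1) * t ^ (-(m + 1) - 1))
      (v' := fun t => deriv f (x - t) - deriv f (x + t))
      (fun t ht => hasDerivAt_rpow_const (Or.inl (hpos t ht).ne')) (fun t _ => hgd t)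
      ((hrpow _).const_smul (-(m + 1))).intervalIntegrable
      (Continuous.intervalIntegrable (by fun_prop) _ _)
    have heq : ∫ t in p.1..p.2, ((x - (x + t)) * deriv f (x + t) * |x - (x + t)| ^ (-(m + 2)) +
          (x - (x - t)) * deriv f (x - t) * |x - (x - t)| ^ (-(m + 2))) =
        ∫ t in p.1..p.2, t ^ (-(m + 1)) * (deriv f (x - t) - deriv f (x + t)) := by
      refine intervalIntegral.integral_congr fun t ht => ?_
      have ht := hpos t ht
      simp only [sub_add_cancel_left, sub_sub_cancel, abs_neg, abs_of_pos ht]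
      rw [show -(m + 1) = 1 + -(m + 2) by ring, rpow_add ht, rpow_one]
      ring
    have hscale : ∫ t in p.1..p.2, -(m + 1) * t ^ (-(m + 1) - 1) * g t =
        -(m + 1) * ∫ t in p.1..p.2, g t * t ^ (-(m + 2)) := by
      rw [← intervalIntegral.integral_const_mul]
      congr 1
      ext t
      rw [show -(m + 1) - 1 = -(m + 2) by ring]
      ring
    rw [heq, hparts, hscale]
    simp only [Function.comp_apply]
    ring
  refine ⟨∫ t in Set.Ioi 0, g t * t ^ (-(m + 2)), ?_, hsecond, ?_⟩
  · refine hlim.congr' ?_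
    filter_upwards [hev] with p ⟨hp1, hp2⟩
    rw [setIntegral_annulus_eq (fun y => (f x - f y) * |x - y| ^ (-(m + 2))) x
      (ContinuousOn.mul (by fun_prop) hpow) hp1 hp2]
    refine intervalIntegral.integral_congr fun t ht => ?_
    rw [Set.uIcc_of_le hp2] at ht
    have ht : 0 < t := hp1.trans_le ht.1
    simp only [sub_add_cancel_left, sub_sub_cancel, abs_neg, abs_of_pos ht, hg]
    ring
  · rintro rfl
    rw [show (0 : ℝ) + 1 = 1 from zero_add 1, one_mul] at hsecond
    refine (hsecond.const_mul (1 / π)).congr fun p => ?_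
    congr 2
    ext y
    rw [zero_add, rpow_neg (abs_nonneg _), rpow_two, sq_abs]
    rcases eq_or_ne (x - y) 0 with h | h
    · simp [h]
    · field_simp
end

section
/- Let −1 < m < 1 and A > 0. Let ρ : ℝ → ℝ be 1-periodic, Lipschitz continuous, nonnegative, with ∫_Ω ρ = A, and let u(x) := ∫_0^x (ρ(t) − A) dt (a 1-periodic Lipschitz function). Then for every x ∈ ℝ the principal value v(x) := lim_{δ→0⁺} ∫_{{y : δ ≤ |x−y| ≤ 1/2}} D_m(x−y) ρ(y) dy exists, and ∫_Ω u(x) v(x) dx = ∫_Ω ∫_Ω K_m(x−y) (ρ(x) − A)(ρ(y) − A) dx dy. -/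
open Real Filter Topology MeasureTheory

/-- The periodic cell `Ω = [-1/2, 1/2]`. -/
noncomputable def Omega : Set ℝ := Set.Icc (-(1/2) : ℝ) (1/2)

/-- `D_m(w) = ∑_{k=0}^∞ [(k+w)^{-(m+1)} - (k+1-w)^{-(m+1)}]` for `w ∈ (0,1)`,
extended `1`-periodically (via the fractional part). -/
noncomputable def Dm (m w : ℝ) : ℝ :=
  ∑' k : ℕ, (((k : ℝ) + Int.fract w) ^ (-(m + 1)) - ((k : ℝ) + 1 - Int.fract w) ^ (-(m + 1)))

/-- `K_m(z) = ∫_z^{1/2} D_m(w) dw` for `z ∈ (0,1/2]`, extended to an even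
`1`-periodic function on `ℝ` (here `|z - round z|` is the distance of `z` to `ℤ`). -/
noncomputable def Km (m z : ℝ) : ℝ :=
  ∫ w in Set.Ioc (|z - (round z : ℝ)|) (1/2 : ℝ), Dm m w

lemma Dm_neg_of_fract_ne_zero (m : ℝ) {w : ℝ} (hw : Int.fract w ≠ 0) :
    Dm m (-w) = -Dm m w := by
  unfold Dm
  rw [Int.fract_neg hw, ← tsum_neg]
  refine tsum_congr fun k => ?_
  rw [show (k : ℝ) + (1 - Int.fract w) = k + 1 - Int.fract w by ring,
    show (k : ℝ) + 1 - (1 - Int.fract w) = k + Int.fract w by ring, neg_sub]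

lemma summable_sub_succ_of_antitone {a : ℕ → ℝ} (ha : Antitone a) (h0 : ∀ n, 0 ≤ a n) :
    Summable fun n => a n - a (n + 1) := by
  refine summable_of_sum_range_le (c := a 0) (fun n => sub_nonneg.2 (ha n.le_succ)) fun n => ?_
  rw [Finset.sum_range_sub']
  linarith [h0 n]

/-- On `(0, 1/2]` the kernel differs from its leading singularity by a continuous
function. -/
lemma exists_Dm_eq_rpow_add {m : ℝ} (hm : -1 < m) :
    ∃ S : ℝ → ℝ, ContinuousOn S (Set.Icc 0 (1 / 2)) ∧
      ∀ w ∈ Set.Ioc (0 : ℝ) (1 / 2), Dm m w = w ^ (-(m + 1)) + S w := by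
  set s : ℝ := -(m + 1) with hs
  have hs0 : s ≤ 0 := by linarith
  set a : ℕ → ℝ := fun k => ((k : ℝ) + 1) ^ s with ha
  have ha_anti : Antitone a := fun i j hij =>
    Real.rpow_le_rpow_of_nonpos (by positivity) (by gcongr) hs0
  have hsum := summable_sub_succ_of_antitone ha_anti fun n => by positivity
  set t : ℕ → ℝ → ℝ := fun k w => (((k : ℝ) + 1) + w) ^ s - (((k : ℝ) + 1) + 1 - w) ^ s with ht
  have hcont : ∀ k : ℕ, ContinuousOn (t k) (Set.Icc 0 (1 / 2)) := by
    intro k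
    refine ContinuousOn.sub (ContinuousOn.rpow_const (by fun_prop) ?_)
      (ContinuousOn.rpow_const (by fun_prop) ?_) <;>
    · intro w hw
      left
      have : (0 : ℝ) ≤ k := k.cast_nonneg
      have := hw.1
      have := hw.2
      intro h
      linarith
  have hbound : ∀ (k : ℕ) (w : ℝ), w ∈ Set.Icc (0 : ℝ) (1 / 2) → ‖t k w‖ ≤ a k - a (k + 1) := by
    intro k w hw
    have hk : (0 : ℝ) ≤ k := k.cast_nonneg
    have h1 := hw.1
    have h2 := hw.2
    have e1 : ((k : ℝ) + 1 + w) ^ s ≤ a k :=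
      Real.rpow_le_rpow_of_nonpos (by positivity) (by linarith) hs0
    have e2 : a (k + 1) ≤ ((k : ℝ) + 1 + 1 - w) ^ s :=
      Real.rpow_le_rpow_of_nonpos (by linarith) (by push_cast; linarith) hs0
    have e3 : ((k : ℝ) + 1 + 1 - w) ^ s ≤ ((k : ℝ) + 1 + w) ^ s :=
      Real.rpow_le_rpow_of_nonpos (by linarith) (by linarith) hs0
    rw [Real.norm_of_nonneg (sub_nonneg.2 e3)]
    linarith
  have hScont : ContinuousOn (fun w => -(1 - w) ^ s + ∑' k, t k w) (Set.Icc 0 (1 / 2)) := by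
    refine ContinuousOn.add (ContinuousOn.neg (ContinuousOn.rpow_const (by fun_prop) ?_))
      (continuousOn_tsum hcont hsum hbound)
    intro w hw
    left
    have := hw.2
    intro h
    linarith
  refine ⟨_, hScont, fun w hw => ?_⟩
  have hfr : Int.fract w = w := Int.fract_eq_self.2 ⟨hw.1.le, by linarith [hw.2]⟩
  have hsw : Summable fun k => t k w :=
    Summable.of_norm_bounded hsum fun k => hbound k w ⟨hw.1.le, hw.2⟩
  have hshift : ∀ k : ℕ, t k w = (((k + 1 : ℕ) : ℝ) + w) ^ s - (((k + 1 : ℕ) : ℝ) + 1 - w) ^ s := by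
    intro k
    simp [ht]
  unfold Dm
  rw [hfr, Summable.tsum_eq_zero_add]
  · simp_rw [← hs, ← hshift]
    simp
    ring
  · rw [← summable_nat_add_iff 1]
    simpa only [← hs, ← hshift] using hsw

lemma integrableOn_mul_Dm {m : ℝ} (hm : -1 < m) (hm' : m < 1) :
    IntegrableOn (fun w => w * Dm m w) (Set.Ioc 0 (1 / 2)) := by
  obtain ⟨S, hS, hDm⟩ := exists_Dm_eq_rpow_add hm
  have h1 : IntegrableOn (fun w : ℝ => w ^ (-m)) (Set.Ioc 0 (1 / 2)) :=
    (intervalIntegrable_iff_integrableOn_Ioc_of_le (by norm_num)).1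
      (intervalIntegral.intervalIntegrable_rpow' (by linarith))
  have h2 : IntegrableOn (fun w : ℝ => w * S w) (Set.Ioc 0 (1 / 2)) :=
    ((continuousOn_id.mul hS).integrableOn_Icc).mono_set Set.Ioc_subset_Icc_self
  refine (h1.add h2).congr_fun (fun w hw => ?_) measurableSet_Ioc
  simp only [Pi.add_apply]
  rw [hDm w hw, mul_add, show -m = 1 + -(m + 1) by ring, Real.rpow_add hw.1, Real.rpow_one]

lemma integrableOn_of_integrableOn_mul_id {D : ℝ → ℝ} {b : ℝ}
    (hD : IntegrableOn (fun w => w * D w) (Set.Ioc 0 b)) {δ : ℝ} (hδ : 0 < δ) :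
    IntegrableOn D (Set.Icc δ b) := by
  have h : IntegrableOn (fun w => w * D w) (Set.Icc δ b) :=
    hD.mono_set fun w hw => ⟨hδ.trans_le hw.1, hw.2⟩
  have h2 : IntegrableOn (fun w => w⁻¹ * (w * D w)) (Set.Icc δ b) := by
    refine Integrable.bdd_mul (c := δ⁻¹) h (by fun_prop) ?_
    refine (ae_restrict_iff' measurableSet_Icc).2 (Eventually.of_forall fun w hw => ?_)
    rw [norm_inv, Real.norm_of_nonneg (hδ.le.trans hw.1)]
    exact inv_anti₀ hδ hw.1
  refine h2.congr_fun (fun w hw => ?_) measurableSet_Icc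
  exact inv_mul_cancel_left₀ (hδ.trans_le hw.1).ne' _

lemma aestronglyMeasurable_of_integrableOn_mul_id {D : ℝ → ℝ} {b : ℝ}
    (hD : IntegrableOn (fun w => w * D w) (Set.Ioc 0 b)) :
    AEStronglyMeasurable D (volume.restrict (Set.Ioc 0 b)) := by
  have h : AEStronglyMeasurable (fun w : ℝ => w⁻¹ * (w * D w)) (volume.restrict (Set.Ioc 0 b)) :=
    (by fun_prop : AEStronglyMeasurable (fun w : ℝ => w⁻¹) _).mul hD.aestronglyMeasurable
  refine h.congr ((ae_restrict_iff' measurableSet_Ioc).2 (Eventually.of_forall fun w hw => ?_))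
  exact inv_mul_cancel_left₀ hw.1.ne' _

/-- The triangle `{z < w}` weighted by `D w` is integrable when `w * D w` is. -/
lemma integrable_indicator_triangle {D : ℝ → ℝ} {b : ℝ}
    (hD : IntegrableOn (fun w => w * D w) (Set.Ioc 0 b)) :
    Integrable (fun p : ℝ × ℝ => {p : ℝ × ℝ | p.1 < p.2}.indicator (fun p => D p.2) p)
      ((volume.restrict (Set.Ioc 0 b)).prod (volume.restrict (Set.Ioc 0 b))) := by
  have hT : MeasurableSet {p : ℝ × ℝ | p.1 < p.2} := measurableSet_lt measurable_fst measurable_snd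
  have hmeas : AEStronglyMeasurable
      (fun p : ℝ × ℝ => {p : ℝ × ℝ | p.1 < p.2}.indicator (fun p => D p.2) p)
      ((volume.restrict (Set.Ioc 0 b)).prod (volume.restrict (Set.Ioc 0 b))) :=
    (aestronglyMeasurable_of_integrableOn_mul_id hD).comp_snd.indicator hT
  have key : ∀ w : ℝ, (fun z : ℝ => {p : ℝ × ℝ | p.1 < p.2}.indicator (fun p => D p.2) (z, w)) =
      (Set.Iio w).indicator fun _ => D w := by
    intro w
    ext z
    simp [Set.indicator]
  rw [integrable_prod_iff' hmeas]
  constructor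
  · refine Eventually.of_forall fun w => ?_
    rw [key]
    exact (integrable_const _).indicator measurableSet_Iio
  · refine hD.norm.congr ((ae_restrict_iff' measurableSet_Ioc).2
      (Eventually.of_forall fun w hw => ?_))
    have : (fun z : ℝ => ‖{p : ℝ × ℝ | p.1 < p.2}.indicator (fun p => D p.2) (z, w)‖) =
        (Set.Iio w).indicator fun _ => ‖D w‖ := by
      ext z
      rw [congrFun (key w) z, norm_indicator_eq_indicator_norm]
    simp only [this]
    rw [integral_indicator measurableSet_Iio, Measure.restrict_restrict measurableSet_Iio,
      show Set.Iio w ∩ Set.Ioc 0 b = Set.Ioo 0 w by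
        ext z
        simp only [Set.mem_inter_iff, Set.mem_Iio, Set.mem_Ioc, Set.mem_Ioo]
        exact ⟨fun h => ⟨h.2.1, h.1⟩, fun h => ⟨h.2, h.1, h.2.le.trans hw.2⟩⟩]
    simp [Real.norm_of_nonneg hw.1.le, hw.1.le]

lemma setIntegral_indicator_triangle {D : ℝ → ℝ} {b z : ℝ} (hz : 0 ≤ z) :
    ∫ w in Set.Ioc 0 b, {p : ℝ × ℝ | p.1 < p.2}.indicator (fun p => D p.2) (z, w) =
      ∫ w in Set.Ioc z b, D w := by
  have : (fun w : ℝ => {p : ℝ × ℝ | p.1 < p.2}.indicator (fun p => D p.2) (z, w)) =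
      (Set.Ioi z).indicator D := by
    ext w
    simp [Set.indicator]
  rw [this, integral_indicator measurableSet_Ioi, Measure.restrict_restrict measurableSet_Ioi]
  congr 2
  ext w
  simp only [Set.mem_inter_iff, Set.mem_Ioi, Set.mem_Ioc]
  exact ⟨fun h => ⟨h.1, h.2.2⟩, fun h => ⟨h.1, hz.trans_lt h.1, h.2⟩⟩

lemma integrableOn_primitive {D : ℝ → ℝ} {b : ℝ}
    (hD : IntegrableOn (fun w => w * D w) (Set.Ioc 0 b)) :
    IntegrableOn (fun z => ∫ w in Set.Ioc z b, D w) (Set.Ioc 0 b) :=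
  IntegrableOn.congr_fun (integrable_indicator_triangle hD).integral_prod_left
    (fun _ hz => setIntegral_indicator_triangle hz.1.le) measurableSet_Ioc

lemma setIntegral_primitive_mul {D : ℝ → ℝ} {b : ℝ}
    (hD : IntegrableOn (fun w => w * D w) (Set.Ioc 0 b)) {h : ℝ → ℝ} (hh : Continuous h) :
    ∫ z in Set.Ioc 0 b, (∫ w in Set.Ioc z b, D w) * h z =
      ∫ w in Set.Ioc 0 b, D w * ∫ z in (0 : ℝ)..w, h z := by
  obtain ⟨C, hC⟩ := isCompact_Icc.exists_bound_of_continuousOn (s := Set.Icc 0 b) hh.continuousOn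
  have hint : Integrable (Function.uncurry fun z w : ℝ =>
      {p : ℝ × ℝ | p.1 < p.2}.indicator (fun p => D p.2) (z, w) * h z)
      ((volume.restrict (Set.Ioc 0 b)).prod (volume.restrict (Set.Ioc 0 b))) := by
    refine Integrable.mul_bdd (c := C) (integrable_indicator_triangle hD)
      (hh.comp continuous_fst).aestronglyMeasurable ?_
    rw [Measure.prod_restrict]
    refine (ae_restrict_iff' (measurableSet_Ioc.prod measurableSet_Ioc)).2
      (Eventually.of_forall fun p hp => hC _ (Set.Ioc_subset_Icc_self hp.1))
  calc ∫ z in Set.Ioc 0 b, (∫ w in Set.Ioc z b, D w) * h z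
      = ∫ z in Set.Ioc 0 b, ∫ w in Set.Ioc 0 b,
          {p : ℝ × ℝ | p.1 < p.2}.indicator (fun p => D p.2) (z, w) * h z := by
        refine setIntegral_congr_fun measurableSet_Ioc fun z hz => ?_
        rw [integral_mul_const, setIntegral_indicator_triangle hz.1.le]
    _ = ∫ w in Set.Ioc 0 b, ∫ z in Set.Ioc 0 b,
          {p : ℝ × ℝ | p.1 < p.2}.indicator (fun p => D p.2) (z, w) * h z :=
        integral_integral_swap hint
    _ = ∫ w in Set.Ioc 0 b, D w * ∫ z in (0 : ℝ)..w, h z := by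
        refine setIntegral_congr_fun measurableSet_Ioc fun w hw => ?_
        have : (fun z : ℝ => {p : ℝ × ℝ | p.1 < p.2}.indicator (fun p => D p.2) (z, w) * h z) =
            (Set.Iio w).indicator fun z => D w * h z := by
          ext z
          by_cases hzw : z < w <;> simp [hzw]
        simp only [this]
        rw [integral_indicator measurableSet_Iio, Measure.restrict_restrict measurableSet_Iio,
          show Set.Iio w ∩ Set.Ioc 0 b = Set.Ioo 0 w by
            ext z
            simp only [Set.mem_inter_iff, Set.mem_Iio, Set.mem_Ioc, Set.mem_Ioo]
            exact ⟨fun h => ⟨h.2.1, h.1⟩, fun h => ⟨h.2, h.1, h.2.le.trans hw.2⟩⟩,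
          integral_const_mul, ← integral_Ioc_eq_integral_Ioo,
          intervalIntegral.integral_of_le hw.1.le]

lemma setIntegral_truncated_eq {D ρ : ℝ → ℝ} {b : ℝ}
    (hD : IntegrableOn (fun w => w * D w) (Set.Ioc 0 b))
    (hodd : ∀ z ∈ Set.Ioc 0 b, D (-z) = -D z) (hρ : Continuous ρ) (x : ℝ) {δ : ℝ}
    (hδ : 0 < δ) (hδb : δ ≤ b) :
    ∫ y in {y : ℝ | δ ≤ |x - y| ∧ |x - y| ≤ b}, D (x - y) * ρ y =
      ∫ z in δ..b, D z * (ρ (x - z) - ρ (x + z)) := by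
  set F : ℝ → ℝ := fun z => D z * ρ (x - z) with hF
  set S : Set ℝ := Set.Icc δ b ∪ Set.Icc (-b) (-δ) with hS
  have hSmeas : MeasurableSet S := measurableSet_Icc.union measurableSet_Icc
  have hset : {y : ℝ | δ ≤ |x - y| ∧ |x - y| ≤ b} = (fun y => x - y) ⁻¹' S := by
    ext y
    simp only [Set.mem_ofPred_eq, hS, Set.mem_preimage, Set.mem_union, Set.mem_Icc]
    rcases abs_cases (x - y) with h | h <;> grind
  have hDδ : IntegrableOn D (Set.Icc δ b) := integrableOn_of_integrableOn_mul_id hD hδ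
  have hmul : ∀ g : ℝ → ℝ, Continuous g → IntervalIntegrable (fun z => D z * g z) volume δ b := by
    intro g hg
    refine IntervalIntegrable.mul_continuousOn ?_ hg.continuousOn
    exact (intervalIntegrable_iff_integrableOn_Icc_of_le hδb).2 hDδ
  have hFpos : IntervalIntegrable F volume δ b := hmul (fun z => ρ (x - z)) (by fun_prop)
  have hreflect : ∀ z ∈ Set.uIcc δ b, F (-z) = -(D z * ρ (x + z)) := by
    intro z hz
    rw [Set.uIcc_of_le hδb] at hz
    simp only [hF]
    rw [hodd z ⟨hδ.trans_le hz.1, hz.2⟩, sub_neg_eq_add]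
    ring
  have hFneg : IntervalIntegrable F volume (-b) (-δ) := by
    rw [IntervalIntegrable.iff_comp_neg, neg_neg, neg_neg]
    refine ((hmul (fun z => ρ (x + z)) (by fun_prop)).neg.congr ?_).symm
    intro z hz
    exact (hreflect z (Set.uIoc_subset_uIcc hz)).symm
  have hneg : ∫ z in (-b)..(-δ), F z = -∫ z in δ..b, D z * ρ (x + z) := by
    rw [← intervalIntegral.integral_comp_neg, intervalIntegral.integral_congr hreflect,
      intervalIntegral.integral_neg]
  have hdisj : Disjoint (Set.Icc δ b) (Set.Icc (-b) (-δ)) := by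
    rw [Set.disjoint_left]
    intro z h1 h2
    linarith [h1.1, h2.2]
  calc ∫ y in {y : ℝ | δ ≤ |x - y| ∧ |x - y| ≤ b}, D (x - y) * ρ y
      = ∫ y, S.indicator F (x - y) := by
        rw [hset, ← integral_indicator (hSmeas.preimage (by fun_prop))]
        refine integral_congr_ae (Eventually.of_forall fun y => ?_)
        by_cases hy : x - y ∈ S <;> simp [Set.indicator, hy, hF]
    _ = ∫ z in S, F z := by
        rw [integral_sub_left_eq_self (fun z => S.indicator F z) volume x,
          integral_indicator hSmeas]
    _ = (∫ z in δ..b, F z) + ∫ z in (-b)..(-δ), F z := by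
        rw [hS, setIntegral_union hdisj measurableSet_Icc
          ((intervalIntegrable_iff_integrableOn_Icc_of_le hδb).1 hFpos)
          ((intervalIntegrable_iff_integrableOn_Icc_of_le (by linarith)).1 hFneg),
          integral_Icc_eq_integral_Ioc, integral_Icc_eq_integral_Ioc,
          intervalIntegral.integral_of_le hδb, intervalIntegral.integral_of_le (by linarith)]
    _ = ∫ z in δ..b, D z * (ρ (x - z) - ρ (x + z)) := by
        rw [hneg, ← sub_eq_add_neg, ← intervalIntegral.integral_sub hFpos
          (hmul (fun z => ρ (x + z)) (by fun_prop))]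
        simp only [hF, mul_sub]

lemma abs_sub_reflection_le {ρ : ℝ → ℝ} {L : NNReal} (hρ : LipschitzWith L ρ) (x : ℝ) {z : ℝ}
    (hz : 0 ≤ z) : ‖ρ (x - z) - ρ (x + z)‖ ≤ 2 * L * z := by
  have h := hρ.dist_le_mul (x - z) (x + z)
  rw [Real.dist_eq, Real.dist_eq, show x - z - (x + z) = -(2 * z) by ring, abs_neg,
    abs_of_nonneg (a := 2 * z) (by positivity)] at h
  rw [Real.norm_eq_abs]
  linarith

lemma integrableOn_mul_reflection {D ρ : ℝ → ℝ} {b : ℝ}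
    (hD : IntegrableOn (fun w => w * D w) (Set.Ioc 0 b)) {L : NNReal} (hρ : LipschitzWith L ρ)
    (x : ℝ) : IntegrableOn (fun z => D z * (ρ (x - z) - ρ (x + z))) (Set.Ioc 0 b) := by
  have hc := hρ.continuous
  refine (hD.norm.const_mul (2 * L)).mono' ((aestronglyMeasurable_of_integrableOn_mul_id hD).mul
    (by fun_prop)) ((ae_restrict_iff' measurableSet_Ioc).2 (Eventually.of_forall fun z hz => ?_))
  rw [norm_mul, norm_mul, Real.norm_of_nonneg hz.1.le]
  nlinarith [abs_sub_reflection_le hρ x hz.1.le, norm_nonneg (D z)]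

lemma tendsto_principalValue {D ρ : ℝ → ℝ} {b : ℝ} (hb : 0 < b)
    (hD : IntegrableOn (fun w => w * D w) (Set.Ioc 0 b))
    (hodd : ∀ z ∈ Set.Ioc 0 b, D (-z) = -D z) {L : NNReal} (hρ : LipschitzWith L ρ) (x : ℝ) :
    Tendsto (fun δ : ℝ => ∫ y in {y : ℝ | δ ≤ |x - y| ∧ |x - y| ≤ b}, D (x - y) * ρ y)
      (𝓝[>] 0) (𝓝 (∫ z in Set.Ioc 0 b, D z * (ρ (x - z) - ρ (x + z)))) := by
  have hint := integrableOn_mul_reflection hD hρ x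
  have hcont := intervalIntegral.continuousOn_primitive_interval_left (a := 0) (b := b) (μ := volume)
    (f := fun z => D z * (ρ (x - z) - ρ (x + z)))
    (by rwa [Set.uIcc_of_le hb.le, integrableOn_Icc_iff_integrableOn_Ioc])
  rw [Set.uIcc_of_le hb.le] at hcont
  have h0 := (hcont 0 ⟨le_rfl, hb.le⟩).tendsto
  rw [intervalIntegral.integral_of_le hb.le] at h0
  have hle : 𝓝[>] (0 : ℝ) ≤ 𝓝[Set.Icc 0 b] 0 := by
    rw [← nhdsWithin_Ioc_eq_nhdsGT hb]
    exact nhdsWithin_mono _ Set.Ioc_subset_Icc_self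
  refine (h0.mono_left hle).congr' ?_
  filter_upwards [Ioc_mem_nhdsGT hb] with δ hδ
  exact (setIntegral_truncated_eq hD hodd hρ.continuous x hδ.1 hδ.2).symm

lemma integral_mul_setIntegral_reflection_swap {D ρ u : ℝ → ℝ} {b c d : ℝ}
    (hD : IntegrableOn (fun w => w * D w) (Set.Ioc 0 b)) {L : NNReal} (hρ : LipschitzWith L ρ)
    (hu : Continuous u) :
    ∫ x in Set.Ioc c d, u x * ∫ z in Set.Ioc 0 b, D z * (ρ (x - z) - ρ (x + z)) =
      ∫ z in Set.Ioc 0 b, D z * ∫ x in Set.Ioc c d, u x * (ρ (x - z) - ρ (x + z)) := by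
  have hc := hρ.continuous
  have hint : Integrable (Function.uncurry fun x z : ℝ =>
      u x * (D z * (ρ (x - z) - ρ (x + z))))
      ((volume.restrict (Set.Ioc c d)).prod (volume.restrict (Set.Ioc 0 b))) := by
    have hu' : IntegrableOn (fun x => 2 * L * ‖u x‖) (Set.Ioc c d) :=
      (by fun_prop : Continuous fun x => 2 * L * ‖u x‖).integrableOn_Ioc
    refine (hu'.mul_prod hD.norm).mono' ?_ ?_
    · refine AEStronglyMeasurable.mul (Continuous.aestronglyMeasurable (by fun_prop)) ?_
      exact (aestronglyMeasurable_of_integrableOn_mul_id hD).comp_snd.mul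
        (Continuous.aestronglyMeasurable (by fun_prop))
    · rw [Measure.prod_restrict]
      refine (ae_restrict_iff' (measurableSet_Ioc.prod measurableSet_Ioc)).2
        (Eventually.of_forall fun p hp => ?_)
      have hz : 0 ≤ p.2 := hp.2.1.le
      simp only [Function.uncurry]
      rw [norm_mul, norm_mul, norm_mul, Real.norm_of_nonneg hz]
      have h := mul_le_mul_of_nonneg_left (abs_sub_reflection_le hρ p.1 hz)
        (mul_nonneg (norm_nonneg (u p.1)) (norm_nonneg (D p.2)))
      linarith
  simp_rw [← integral_const_mul]
  rw [integral_integral_swap hint]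
  simp_rw [mul_left_comm]

/-- Integrating the primitive `u` of `f` against the odd difference of translates of `f`
gives the primitive of the symmetrized autocorrelation of `f`. -/
lemma integral_primitive_mul_reflection {f u : ℝ → ℝ} (hf : Continuous f)
    (hper : Function.Periodic f 1) (hu : ∀ x, u x = ∫ t in (0 : ℝ)..x, f t)
    (huper : Function.Periodic u 1) (z : ℝ) :
    ∫ x in (-(1 / 2) : ℝ)..(1 / 2), u x * (f (x - z) - f (x + z)) =
      ∫ t in (0 : ℝ)..z, ∫ x in (-(1 / 2) : ℝ)..(1 / 2), f x * (f (x - t) + f (x + t)) := by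
  have hii : ∀ a b : ℝ, IntervalIntegrable f volume a b := fun a b => hf.intervalIntegrable a b
  have hucont : Continuous u := by
    rw [funext hu]
    exact intervalIntegral.continuous_primitive hii 0
  have hshift : ∀ s : ℝ, ∫ x in (-(1 / 2) : ℝ)..(1 / 2), u x * f (x - s) =
      ∫ x in (-(1 / 2) : ℝ)..(1 / 2), u (x + s) * f x := by
    intro s
    have hp : Function.Periodic (fun x => u (x + s) * f x) 1 := by
      intro x
      simp only
      rw [hper x, show x + 1 + s = x + s + 1 by ring, huper]
    have h1 := intervalIntegral.integral_comp_sub_right (a := -(1 / 2)) (b := 1 / 2)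
      (fun x => u (x + s) * f x) s
    simp only [sub_add_cancel] at h1
    have h2 := hp.intervalIntegral_add_eq (-(1 / 2) - s) (-(1 / 2))
    rw [show -(1 / 2) - s + 1 = 1 / 2 - s by ring, show -(1 / 2 : ℝ) + 1 = 1 / 2 by norm_num] at h2
    exact h1.trans h2
  have hdiff : ∀ x : ℝ, u (x + z) - u (x - z) = ∫ t in (0 : ℝ)..z, (f (x - t) + f (x + t)) := by
    intro x
    rw [intervalIntegral.integral_add ((by fun_prop : Continuous _).intervalIntegrable _ _)
      ((by fun_prop : Continuous _).intervalIntegrable _ _),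
      intervalIntegral.integral_comp_sub_left (fun t => f t),
      intervalIntegral.integral_comp_add_left (fun t => f t), sub_zero, add_zero,
      intervalIntegral.integral_add_adjacent_intervals (hii _ _) (hii _ _), hu, hu,
      intervalIntegral.integral_interval_sub_left (hii _ _) (hii _ _)]
  have hplus := hshift (-z)
  simp only [sub_neg_eq_add, ← sub_eq_add_neg] at hplus
  calc ∫ x in (-(1 / 2) : ℝ)..(1 / 2), u x * (f (x - z) - f (x + z))
      = ∫ x in (-(1 / 2) : ℝ)..(1 / 2), (u (x + z) - u (x - z)) * f x := by
        simp_rw [mul_sub, sub_mul]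
        rw [intervalIntegral.integral_sub, intervalIntegral.integral_sub, hshift z, hplus] <;>
        exact (by fun_prop : Continuous _).intervalIntegrable _ _
    _ = ∫ x in (-(1 / 2) : ℝ)..(1 / 2), ∫ t in (0 : ℝ)..z, f x * (f (x - t) + f (x + t)) := by
        refine intervalIntegral.integral_congr fun x _ => ?_
        rw [hdiff, mul_comm, intervalIntegral.integral_const_mul]
    _ = _ := by
        refine intervalIntegral_intervalIntegral_swap ?_
        have hc : Continuous (Function.uncurry fun x t : ℝ => f x * (f (x - t) + f (x + t))) := by
          fun_prop
        exact (hc.integrableOn_Icc (a := ((-(1 / 2) : ℝ) ⊓ (1 / 2), 0 ⊓ z))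
          (b := ((-(1 / 2) : ℝ) ⊔ (1 / 2), 0 ⊔ z))).mono_set (by
            rw [← Set.Icc_prod_Icc]
            exact Set.prod_mono Set.uIoc_subset_uIcc Set.uIoc_subset_uIcc)

/-- The quadratic form of an even periodic kernel in terms of the symmetrized autocorrelation. -/
lemma integral_kernel_mul_eq {f K : ℝ → ℝ} (hf : Continuous f) (hper : Function.Periodic f 1)
    (hK : IntegrableOn K (Set.Ioc 0 (1 / 2))) (hKper : Function.Periodic K 1)
    (hKeven : ∀ z ∈ Set.Ioc (0 : ℝ) (1 / 2), K (-z) = K z) :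
    ∫ x in (-(1 / 2) : ℝ)..(1 / 2), ∫ y in (-(1 / 2) : ℝ)..(1 / 2), K (x - y) * f x * f y =
      ∫ z in (0 : ℝ)..(1 / 2), K z *
        ∫ x in (-(1 / 2) : ℝ)..(1 / 2), f x * (f (x - z) + f (x + z)) := by
  have hKi : IntervalIntegrable K volume 0 (1 / 2) :=
    (intervalIntegrable_iff_integrableOn_Ioc_of_le (by norm_num)).2 hK
  have hinner : ∀ x : ℝ, ∫ y in (-(1 / 2) : ℝ)..(1 / 2), K (x - y) * f x * f y =
      ∫ z in (0 : ℝ)..(1 / 2), K z * (f x * (f (x - z) + f (x + z))) := by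
    intro x
    set G : ℝ → ℝ := fun z => K z * (f x * f (x - z)) with hG
    have hGper : Function.Periodic G 1 := by
      intro z
      simp only [hG]
      rw [hKper z, show x - (z + 1) = x - z - 1 by ring, hper.sub_eq]
    have hpos : IntervalIntegrable G volume 0 (1 / 2) := hKi.mul_continuousOn (by fun_prop)
    have hpos' : IntervalIntegrable (fun z => K z * (f x * f (x + z))) volume 0 (1 / 2) :=
      hKi.mul_continuousOn (by fun_prop)
    have hEq : Set.EqOn (fun z => K z * (f x * f (x + z))) (fun z => G (-z))
        (Set.uIoc 0 (1 / 2)) := by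
      intro z hz
      rw [Set.uIoc_of_le (by norm_num)] at hz
      simp only [hG, hKeven z hz, sub_neg_eq_add]
    have hneg : IntervalIntegrable G volume (-(1 / 2)) 0 := by
      have h := hpos'.congr hEq
      rw [IntervalIntegrable.iff_comp_neg, neg_neg, neg_zero]
      exact h.symm
    calc ∫ y in (-(1 / 2) : ℝ)..(1 / 2), K (x - y) * f x * f y
        = ∫ y in (-(1 / 2) : ℝ)..(1 / 2), G (x - y) := by
          refine intervalIntegral.integral_congr fun y _ => ?_
          simp only [hG, sub_sub_cancel, mul_assoc]
      _ = ∫ z in (-(1 / 2) : ℝ)..(1 / 2), G z := by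
          rw [intervalIntegral.integral_comp_sub_left (fun z => G z)]
          have h := hGper.intervalIntegral_add_eq (x - 1 / 2) (-(1 / 2))
          rwa [show x - 1 / 2 + 1 = x - -(1 / 2) by ring,
            show -(1 / 2 : ℝ) + 1 = 1 / 2 by norm_num] at h
      _ = (∫ z in (0 : ℝ)..(1 / 2), G (-z)) + ∫ z in (0 : ℝ)..(1 / 2), G z := by
          rw [← intervalIntegral.integral_add_adjacent_intervals hneg hpos,
            intervalIntegral.integral_comp_neg (fun z => G z), neg_zero]
      _ = ∫ z in (0 : ℝ)..(1 / 2), K z * (f x * (f (x - z) + f (x + z))) := by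
          rw [← intervalIntegral.integral_congr_ae (Eventually.of_forall fun z hz => hEq hz),
            add_comm, ← intervalIntegral.integral_add hpos hpos']
          simp only [hG, mul_add]
  simp_rw [hinner]
  rw [intervalIntegral_intervalIntegral_swap]
  · simp_rw [intervalIntegral.integral_const_mul]
  · have hc : Continuous fun p : ℝ × ℝ => f p.1 * (f (p.1 - p.2) + f (p.1 + p.2)) := by fun_prop
    rw [Set.uIoc_of_le (by norm_num), Set.uIoc_of_le (by norm_num)]
    obtain ⟨C, hC⟩ := (isCompact_Icc.prod isCompact_Icc).exists_bound_of_continuousOn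
      (s := Set.Icc (-(1 / 2) : ℝ) (1 / 2) ×ˢ Set.Icc (0 : ℝ) (1 / 2)) hc.continuousOn
    have hK2 : IntegrableOn (fun p : ℝ × ℝ => K p.2)
        (Set.Ioc (-(1 / 2) : ℝ) (1 / 2) ×ˢ Set.Ioc (0 : ℝ) (1 / 2)) := by
      rw [IntegrableOn, Measure.volume_eq_prod, ← Measure.prod_restrict]
      exact hK.comp_snd _
    refine Integrable.mul_bdd (c := C) hK2 hc.aestronglyMeasurable ?_
    refine (ae_restrict_iff' (measurableSet_Ioc.prod measurableSet_Ioc)).2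
      (Eventually.of_forall fun p hp => hC _ ?_)
    exact Set.prod_mono Set.Ioc_subset_Icc_self Set.Ioc_subset_Icc_self hp

lemma abs_sub_round_eq_abs {z : ℝ} (hz : z ∈ Set.Ico (-(1 / 2) : ℝ) (1 / 2)) :
    |z - (round z : ℝ)| = |z| := by
  rw [round_eq_zero_iff.2 hz, Int.cast_zero, sub_zero]

lemma Km_of_mem_Ioc (m : ℝ) {z : ℝ} (hz : z ∈ Set.Ioc (0 : ℝ) (1 / 2)) :
    Km m z = ∫ w in Set.Ioc z (1 / 2), Dm m w := by
  have h : |z - (round z : ℝ)| = z := by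
    rcases hz.2.lt_or_eq with h | rfl
    · rw [abs_sub_round_eq_abs ⟨by linarith [hz.1], h⟩, abs_of_pos hz.1]
    · rw [one_div, round_two_inv]
      norm_num
  rw [Km, h]

lemma Km_neg_of_mem_Ioc (m : ℝ) {z : ℝ} (hz : z ∈ Set.Ioc (0 : ℝ) (1 / 2)) :
    Km m (-z) = Km m z := by
  rw [Km_of_mem_Ioc m hz, Km, abs_sub_round_eq_abs ⟨by linarith [hz.2], by linarith [hz.1]⟩,
    abs_neg, abs_of_pos hz.1]

lemma periodic_Km (m : ℝ) : Function.Periodic (Km m) 1 := by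
  intro z
  rw [Km, Km, round_add_one]
  push_cast
  rw [add_sub_add_right_eq_sub]

lemma setIntegral_Omega (g : ℝ → ℝ) :
    ∫ x in Omega, g x = ∫ x in (-(1 / 2) : ℝ)..(1 / 2), g x := by
  rw [Omega, integral_Icc_eq_integral_Ioc, intervalIntegral.integral_of_le (by norm_num)]

theorem stmt_8 (m : ℝ) (hm : -1 < m) (hm' : m < 1) (A : ℝ) (hA : 0 < A)
    (ρ : ℝ → ℝ) (hper : ∀ t : ℝ, ρ (t + 1) = ρ t)
    (hlip : ∃ L : NNReal, LipschitzWith L ρ)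
    (hpos : ∀ t : ℝ, 0 ≤ ρ t)
    (hmean : (∫ t in Omega, ρ t) = A)
    (u : ℝ → ℝ) (hu : ∀ x : ℝ, u x = ∫ t in (0 : ℝ)..x, (ρ t - A)) :
    ∃ v : ℝ → ℝ,
      (∀ x : ℝ, Tendsto (fun δ : ℝ =>
          ∫ y in {y : ℝ | δ ≤ |x - y| ∧ |x - y| ≤ 1/2}, Dm m (x - y) * ρ y)
        (𝓝[>] (0 : ℝ)) (𝓝 (v x))) ∧
      (∫ x in Omega, u x * v x) =
        ∫ x in Omega, ∫ y in Omega, Km m (x - y) * (ρ x - A) * (ρ y - A) := by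
  obtain ⟨L, hL⟩ := hlip
  have hρ : Continuous ρ := hL.continuous
  have hD := integrableOn_mul_Dm hm hm'
  have hodd : ∀ z ∈ Set.Ioc (0 : ℝ) (1 / 2), Dm m (-z) = -Dm m z := by
    intro z hz
    refine Dm_neg_of_fract_ne_zero m ?_
    rw [Int.fract_eq_self.2 ⟨hz.1.le, by linarith [hz.2]⟩]
    exact hz.1.ne'
  refine ⟨_, fun x => tendsto_principalValue (by norm_num) hD hodd hL x, ?_⟩
  set f : ℝ → ℝ := fun t => ρ t - A with hf
  have hfc : Continuous f := hρ.sub continuous_const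
  have hfper : Function.Periodic f 1 := fun t => by simp only [hf, hper t]
  have hii : ∀ a b : ℝ, IntervalIntegrable f volume a b := fun a b => hfc.intervalIntegrable a b
  have huc : Continuous u := by
    rw [funext hu]
    exact intervalIntegral.continuous_primitive hii 0
  have hf0 : ∫ t in (-(1 / 2) : ℝ)..(1 / 2), f t = 0 := by
    rw [setIntegral_Omega] at hmean
    rw [intervalIntegral.integral_sub (hρ.intervalIntegrable _ _)
      (continuous_const.intervalIntegrable _ _), hmean, intervalIntegral.integral_const]
    norm_num
  have huper : Function.Periodic u 1 := by
    intro x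
    have h := hfper.intervalIntegral_add_eq x (-(1 / 2))
    rw [show -(1 / 2 : ℝ) + 1 = 1 / 2 by norm_num, hf0] at h
    rw [hu, hu, ← intervalIntegral.integral_add_adjacent_intervals (hii 0 x) (hii x (x + 1)), h,
      add_zero]
  set h : ℝ → ℝ := fun z => ∫ x in (-(1 / 2) : ℝ)..(1 / 2), f x * (f (x - z) + f (x + z)) with hh
  have hhc : Continuous h :=
    intervalIntegral.continuous_parametric_intervalIntegral_of_continuous' (by fun_prop) _ _
  have hK : IntegrableOn (Km m) (Set.Ioc 0 (1 / 2)) :=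
    (integrableOn_primitive hD).congr_fun (fun z hz => (Km_of_mem_Ioc m hz).symm) measurableSet_Ioc
  calc ∫ x in Omega, u x * ∫ z in Set.Ioc (0 : ℝ) (1 / 2), Dm m z * (ρ (x - z) - ρ (x + z))
      = ∫ z in Set.Ioc (0 : ℝ) (1 / 2),
          Dm m z * ∫ x in Set.Ioc (-(1 / 2) : ℝ) (1 / 2), u x * (ρ (x - z) - ρ (x + z)) := by
        rw [Omega, integral_Icc_eq_integral_Ioc, integral_mul_setIntegral_reflection_swap hD hL huc]
    _ = ∫ z in Set.Ioc (0 : ℝ) (1 / 2), Dm m z * ∫ t in (0 : ℝ)..z, h t := by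
        refine setIntegral_congr_fun measurableSet_Ioc fun z _ => ?_
        rw [← integral_primitive_mul_reflection hfc hfper hu huper,
          intervalIntegral.integral_of_le (by norm_num)]
        simp only [hf, sub_sub_sub_cancel_right]
    _ = ∫ z in Set.Ioc (0 : ℝ) (1 / 2), Km m z * h z := by
        rw [← setIntegral_primitive_mul hD hhc]
        exact setIntegral_congr_fun measurableSet_Ioc fun z hz => by
          simp only [Km_of_mem_Ioc m hz]
    _ = ∫ x in Omega, ∫ y in Omega, Km m (x - y) * (ρ x - A) * (ρ y - A) := by
        simp_rw [setIntegral_Omega]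
        rw [integral_kernel_mul_eq hfc hfper hK (periodic_Km m) fun z => Km_neg_of_mem_Ioc m,
          intervalIntegral.integral_of_le (by norm_num)]
end
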